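/- Let 1 ≤ p < ∞ and θ ≥ 0. If ω ∈ A_p^θ(φ), then there exists a constant C > 0 such that for every cube Q and every locally integrable f, (φ(Q)^θ|Q|)^{-1} ∫_Q |f| ≤ C (ω(5Q)^{-1} ∫_Q |f|^p ω)^{1/p}. In particular, taking f := χ_E for a measurable set E ⊂ Q, |E| / (φ(Q)^θ|Q|) ≤ C (ω(E)/ω(5Q))^{1/p}. -/

import Mathlib

open MeasureTheory ENNReal Set Filter

noncomputable section

/-- `ℝⁿ` with the Euclidean norm. -/
abbrev En (n : ℕ) := EuclideanSpace ℝ (Fin n)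

/-- The (closed) cube centered at `x` with sidelength `r`. -/
def cube {n : ℕ} (x : En n) (r : ℝ) : Set (En n) :=
  {y | ∀ i, |y i - x i| ≤ r / 2}

/-- Weighted `L^p` norm `(∫ |f|^p w)^{1/p}` (valued in `ℝ≥0∞`). -/
def wLp {n : ℕ} (p : ℝ) (w f : En n → ℝ) : ℝ≥0∞ :=
  (∫⁻ x, ENNReal.ofReal (|f x| ^ p * w x)) ^ (1 / p)

/-- Weighted weak `L^p` norm `sup_{t>0} t · w({|f|>t})^{1/p}`. -/
def wLpWeak {n : ℕ} (p : ℝ) (w f : En n → ℝ) : ℝ≥0∞ :=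
  ⨆ (t : ℝ) (_ : 0 < t), ENNReal.ofReal t *
    (∫⁻ x in {x | t < |f x|}, ENNReal.ofReal (w x)) ^ (1 / p)

/-- The dilated kernel `K_t(x,y⃗) = t^{-mn} K(x/t, y⃗/t)`. -/
def Kt {n m : ℕ} (K : En n → (Fin m → En n) → ℝ) (t : ℝ) (x : En n)
    (y : Fin m → En n) : ℝ :=
  t ^ (-(m * n : ℝ)) * K (t⁻¹ • x) fun j => t⁻¹ • y j

/-- The multilinear square function associated with the kernel `K`. -/
def sqOp {n m : ℕ} (K : En n → (Fin m → En n) → ℝ) (f : Fin m → En n → ℝ)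
    (x : En n) : ℝ :=
  (∫ t in Ioi (0 : ℝ),
      (∫ y : Fin m → En n, Kt K t x y * ∏ j, f j (y j)) ^ 2 / t) ^ (1 / 2 : ℝ)

/-- Size condition (1.2). -/
def SizeCond (n m : ℕ) (K : En n → (Fin m → En n) → ℝ) : Prop :=
  ∀ N : ℝ, 0 ≤ N → ∃ C > 0, ∀ (y0 : En n) (y : Fin m → En n),
    0 < ∑ j, dist y0 (y j) →
    (∫ t in Ioi (0 : ℝ), (Kt K t y0 y) ^ 2 / t) ^ (1 / 2 : ℝ) ≤
      C * (∑ j, dist y0 (y j)) ^ (-(m * n : ℝ)) *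
        (1 + ∑ j, dist y0 (y j)) ^ (-N)

/-- The cube `Δ_k = Q(y₀, 2^k √(mn) |y₀ - y₀'|)`. -/
def deltaCube {n : ℕ} (m : ℕ) (y0 y0' : En n) (k : ℕ) : Set (En n) :=
  cube y0 (2 ^ k * Real.sqrt (m * n) * dist y0 y0')

/-- The "annulus" `(Δ_{k+2})^m \ (Δ_{k+1})^m`. -/
def annulus {n : ℕ} (m : ℕ) (y0 y0' : En n) (k : ℕ) : Set (Fin m → En n) :=
  {y | ∀ j, y j ∈ deltaCube m y0 y0' (k + 2)} \
    {y | ∀ j, y j ∈ deltaCube m y0 y0' (k + 1)}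

/-- Generalized smoothness condition (1.4) with constants `Ck`. -/
def GenSmoothCond (n m : ℕ) (q q' : ℝ) (Ck : ℕ → ℝ)
    (K : En n → (Fin m → En n) → ℝ) : Prop :=
  ∀ N : ℝ, 0 ≤ N → ∃ C > 0, ∀ (k : ℕ) (y0 y0' : En n), y0 ≠ y0' →
    (∫ t in Ioi (0 : ℝ),
        (∫ y in annulus m y0 y0' k, |Kt K t y0 y - Kt K t y0' y| ^ q) ^ (2 / q)
          / t) ^ (1 / 2 : ℝ) ≤
      C * Ck k * dist y0 y0' ^ (-(m * n / q')) *
        (1 + 2 ^ k * dist y0 y0') ^ (-N) * (2 : ℝ) ^ (-((k : ℝ) * m * n / q'))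

/-- Definition 1.1: a new multilinear square operator with generalized kernel. -/
structure IsGenSquareOp (n m : ℕ) (q q' : ℝ) (Ck : ℕ → ℝ)
    (K : En n → (Fin m → En n) → ℝ) : Prop where
  ck_pos : ∀ k, 0 < Ck k
  size : SizeCond n m K
  smooth : GenSmoothCond n m q q' Ck K
  weak_bound : ∃ s : Fin m → ℝ, (∀ j, 1 ≤ s j ∧ s j ≤ q') ∧ ∃ C > 0,
    ∀ f : Fin m → En n → ℝ, (∀ j, Measurable (f j)) →
      wLpWeak (∑ j, (s j)⁻¹)⁻¹ (fun _ => 1) (sqOp K f) ≤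
        ENNReal.ofReal C * ∏ j, wLp (s j) (fun _ => 1) (f j)

/-- The multiple weight `ν_{ω⃗} = ∏ ω_j^{p/p_j}`. -/
def nuW {n m : ℕ} (p : Fin m → ℝ) (w : Fin m → En n → ℝ) (x : En n) : ℝ :=
  ∏ j, w j x ^ ((∑ i, (p i)⁻¹)⁻¹ / p j)

/-- The multiple weight class `A_{p⃗}^θ(φ)`. -/
def MultiApTheta (n m : ℕ) (p : Fin m → ℝ) (θ : ℝ) (w : Fin m → En n → ℝ) : Prop :=
  (∀ j x, 0 ≤ w j x) ∧ (∀ j, LocallyIntegrable (w j) volume) ∧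
  ∃ C > 0, ∀ (x : En n) (r : ℝ), 0 < r →
    ((ENNReal.ofReal ((1 + r) ^ θ) * volume (cube x r))⁻¹ *
        ∫⁻ y in cube x r, ENNReal.ofReal (nuW p w y)) ^ (∑ i, (p i)⁻¹) *
      ∏ j,
        (if p j = 1 then
          (essInf (fun y => ENNReal.ofReal (w j y)) (volume.restrict (cube x r)))⁻¹
        else
          ((ENNReal.ofReal ((1 + r) ^ θ) * volume (cube x r))⁻¹ *
            ∫⁻ y in cube x r,
              ENNReal.ofReal (w j y) ^ (1 - p j / (p j - 1))) ^ (1 - (p j)⁻¹))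
      ≤ ENNReal.ofReal C



/-- The scalar weight class `A_p^θ(φ)` (with the `ess inf` convention at `p = 1`). -/
def ApTheta (n : ℕ) (p θ : ℝ) (w : En n → ℝ) : Prop :=
  (∀ x, 0 ≤ w x) ∧ LocallyIntegrable w volume ∧
  ∃ C > 0, ∀ (x : En n) (r : ℝ), 0 < r →
    if p = 1 then
      (ENNReal.ofReal ((1 + r) ^ θ) * volume (cube x r))⁻¹ *
          (∫⁻ y in cube x r, ENNReal.ofReal (w y)) ≤
        ENNReal.ofReal C *
          essInf (fun y => ENNReal.ofReal (w y)) (volume.restrict (cube x r))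
    else
      ((ENNReal.ofReal ((1 + r) ^ θ) * volume (cube x r))⁻¹ *
          ∫⁻ y in cube x r, ENNReal.ofReal (w y)) ^ (1 / p) *
        ((ENNReal.ofReal ((1 + r) ^ θ) * volume (cube x r))⁻¹ *
          ∫⁻ y in cube x r, ENNReal.ofReal (w y) ^ (-1 / (p - 1))) ^ (1 - 1 / p) ≤
        ENNReal.ofReal C

/-- Dyadic cube of generation `k` indexed by `v ∈ ℤⁿ`; its sidelength is `2^{-k}`. -/
def dyadicCube (n : ℕ) (k : ℤ) (v : Fin n → ℤ) : Set (En n) :=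
  {y | ∀ i, (v i : ℝ) * 2 ^ (-k) ≤ y i ∧ y i < ((v i : ℝ) + 1) * 2 ^ (-k)}

/-- Average of `f` on `Q`. -/
def cubeAvg {n : ℕ} (Q : Set (En n)) (f : En n → ℝ) : ℝ :=
  (volume Q).toReal⁻¹ * ∫ y in Q, f y

/-- The dyadic maximal function `M^△_{φ,η}`. -/
def dyadicMax (n : ℕ) (η : ℝ) (f : En n → ℝ) (x : En n) : ℝ≥0∞ :=
  ⨆ (k : ℤ) (v : Fin n → ℤ) (_ : x ∈ dyadicCube n k v),
    (ENNReal.ofReal ((1 + (2 : ℝ) ^ (-k)) ^ η) * volume (dyadicCube n k v))⁻¹ *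
      ∫⁻ y in dyadicCube n k v, ENNReal.ofReal |f y|

/-- The dyadic sharp maximal function `M^{♯,△}_{φ,η}`. -/
def sharpMax (n : ℕ) (η : ℝ) (f : En n → ℝ) (x : En n) : ℝ≥0∞ :=
  (⨆ (k : ℤ) (v : Fin n → ℤ) (_ : x ∈ dyadicCube n k v) (_ : (2 : ℝ) ^ (-k) < 1),
      (volume (dyadicCube n k v))⁻¹ *
        ∫⁻ y in dyadicCube n k v,
          ENNReal.ofReal |f y - cubeAvg (dyadicCube n k v) f|) +
  ⨆ (k : ℤ) (v : Fin n → ℤ) (_ : x ∈ dyadicCube n k v) (_ : 1 ≤ (2 : ℝ) ^ (-k)),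
    (ENNReal.ofReal ((1 + (2 : ℝ) ^ (-k)) ^ η) * volume (dyadicCube n k v))⁻¹ *
      ∫⁻ y in dyadicCube n k v, ENNReal.ofReal |f y|

def dyadicMaxDelta (n : ℕ) (δ η : ℝ) (f : En n → ℝ) (x : En n) : ℝ≥0∞ :=
  (dyadicMax n η (fun y => |f y| ^ δ) x) ^ (1 / δ)

def sharpMaxDelta (n : ℕ) (δ η : ℝ) (f : En n → ℝ) (x : En n) : ℝ≥0∞ :=
  (sharpMax n η (fun y => |f y| ^ δ) x) ^ (1 / δ)

/-- The multilinear maximal operator `𝓜_{φ,η}`. -/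
def multiMax (n m : ℕ) (η : ℝ) (f : Fin m → En n → ℝ) (x : En n) : ℝ≥0∞ :=
  ⨆ (c : En n) (r : ℝ) (_ : 0 < r) (_ : x ∈ cube c r),
    ∏ j, (ENNReal.ofReal ((1 + r) ^ η) * volume (cube c r))⁻¹ *
      ∫⁻ y in cube c r, ENNReal.ofReal |f j y|

def multiMaxDelta (n m : ℕ) (δ η : ℝ) (f : Fin m → En n → ℝ) (x : En n) : ℝ≥0∞ :=
  (multiMax n m η (fun j y => |f j y| ^ δ) x) ^ (1 / δ)

/-- `L^l` "norm" (in `z`) of an `ℝ≥0∞`-valued function, allowing `l = ∞`. -/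
def lpFull (n : ℕ) (l : ℝ≥0∞) (g : En n → ℝ≥0∞) : ℝ≥0∞ :=
  if l = ∞ then essSup g volume
  else (∫⁻ z, g z ^ l.toReal) ^ (1 / l.toReal)

/-- Weighted `L^p` norm of `f` restricted to `Q`, i.e. `‖f χ_Q‖_{L^p(w)}`. -/
def wLpOn {n : ℕ} (Q : Set (En n)) (p : ℝ) (w f : En n → ℝ) : ℝ≥0∞ :=
  (∫⁻ x in Q, ENNReal.ofReal (|f x| ^ p * w x)) ^ (1 / p)

/-- Weighted weak `L^p` norm of `f χ_Q`. -/
def wLpWeakOn {n : ℕ} (Q : Set (En n)) (p : ℝ) (w f : En n → ℝ) : ℝ≥0∞ :=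
  ⨆ (t : ℝ) (_ : 0 < t), ENNReal.ofReal t *
    (∫⁻ x in Q ∩ {x | t < |f x|}, ENNReal.ofReal (w x)) ^ (1 / p)

/-- `u(Q) = ∫_Q u`. -/
def wInt {n : ℕ} (Q : Set (En n)) (u : En n → ℝ) : ℝ≥0∞ :=
  ∫⁻ x in Q, ENNReal.ofReal (u x)

/-- The strong Morrey norm `‖f‖_{M^{p,l}_{α,λ}(u,w)}`. -/
def morreyNorm (n : ℕ) (α lam p : ℝ) (l : ℝ≥0∞) (u w f : En n → ℝ) : ℝ≥0∞ :=
  ⨆ (r : ℝ) (_ : 0 < r), lpFull n l fun z =>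
    ENNReal.ofReal ((1 + r) ^ α) * (wInt (cube z r) u) ^ (-lam) *
      wLpOn (cube z r) p w f

/-- The weak Morrey norm `‖f‖_{WM^{p,l}_{α,λ}(u,w)}`. -/
def weakMorreyNorm (n : ℕ) (α lam p : ℝ) (l : ℝ≥0∞) (u w f : En n → ℝ) : ℝ≥0∞ :=
  ⨆ (r : ℝ) (_ : 0 < r), lpFull n l fun z =>
    ENNReal.ofReal ((1 + r) ^ α) * (wInt (cube z r) u) ^ (-lam) *
      wLpWeakOn (cube z r) p w f

/-- The vector-valued Morrey norm `‖f⃗‖_{M^{p⃗,l}_{α,λ}(u,w⃗)}`. -/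
def vecMorreyNorm (n m : ℕ) (α lam : ℝ) (p : Fin m → ℝ) (l : ℝ≥0∞)
    (u : En n → ℝ) (w : Fin m → En n → ℝ) (f : Fin m → En n → ℝ) : ℝ≥0∞ :=
  ⨆ (r : ℝ) (_ : 0 < r), lpFull n l fun z =>
    ENNReal.ofReal ((1 + r) ^ α) * (wInt (cube z r) u) ^ (-lam) *
      ∏ j, wLpOn (cube z r) (p j) (w j) (f j)

/-- Weighted `L^p` norm of an `ℝ≥0∞`-valued function. -/
def wLpE (n : ℕ) (p : ℝ) (w : En n → ℝ) (g : En n → ℝ≥0∞) : ℝ≥0∞ :=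
  (∫⁻ x, g x ^ p * ENNReal.ofReal (w x)) ^ (1 / p)

/-- Weighted weak `L^p` norm of an `ℝ≥0∞`-valued function. -/
def wLpWeakE (n : ℕ) (p : ℝ) (w : En n → ℝ) (g : En n → ℝ≥0∞) : ℝ≥0∞ :=
  ⨆ (t : ℝ) (_ : 0 < t), ENNReal.ofReal t *
    (∫⁻ x in {x | ENNReal.ofReal t < g x}, ENNReal.ofReal (w x)) ^ (1 / p)


theorem cube_eq_pre {n : ℕ} (x : En n) (r : ℝ) :
    cube x r = (WithLp.ofLp : En n → (Fin n → ℝ)) ⁻¹'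
      (Set.Icc (fun i => x i - r / 2) (fun i => x i + r / 2)) := by
  ext y
  simp only [cube, Set.mem_setOf_eq, Set.mem_preimage, Set.mem_Icc, Pi.le_def]
  rw [← forall_and]
  refine forall_congr' fun i => ?_
  rw [abs_le]
  constructor <;> rintro ⟨h1, h2⟩ <;> constructor <;> linarith

theorem cube_volume {n : ℕ} (x : En n) (r : ℝ) :
    volume (cube x r) = ENNReal.ofReal r ^ n := by
  rw [cube_eq_pre, (PiLp.volume_preserving_ofLp (Fin n)).measure_preimage
    measurableSet_Icc.nullMeasurableSet, Real.volume_Icc_pi]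
  simp

theorem cube_compact {n : ℕ} (x : En n) (r : ℝ) : IsCompact (cube x r) := by
  rw [cube_eq_pre]
  exact (PiLp.homeomorph 2 (fun _ : Fin n => ℝ)).isCompact_preimage.2 isCompact_Icc

theorem cube_meas {n : ℕ} (x : En n) (r : ℝ) : MeasurableSet (cube x r) :=
  (cube_compact x r).measurableSet

theorem cube_mono {n : ℕ} (x : En n) {r : ℝ} (hr : 0 < r) : cube x r ⊆ cube x (5 * r) := by
  intro y hy i
  have := hy i
  linarith

theorem D_le {n : ℕ} (θ : ℝ) (hθ : 0 ≤ θ) (x : En n) (r : ℝ) (hr : 0 < r) :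
    (ENNReal.ofReal ((1 + r) ^ θ) * volume (cube x r))⁻¹ ≤
      ENNReal.ofReal (5 ^ θ * 5 ^ n) *
        (ENNReal.ofReal ((1 + 5 * r) ^ θ) * volume (cube x (5 * r)))⁻¹ := by
  rw [cube_volume, cube_volume, ← ENNReal.ofReal_pow hr.le, ← ENNReal.ofReal_pow (by positivity),
    ← ENNReal.ofReal_mul (by positivity), ← ENNReal.ofReal_mul (by positivity),
    ← ENNReal.ofReal_inv_of_pos (by positivity), ← ENNReal.ofReal_inv_of_pos (by positivity),
    ← ENNReal.ofReal_mul (by positivity)]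
  apply ENNReal.ofReal_le_ofReal
  have h : (1 + 5 * r) ^ θ ≤ 5 ^ θ * (1 + r) ^ θ := by
    rw [← Real.mul_rpow (by norm_num) (by positivity)]
    exact Real.rpow_le_rpow (by positivity) (by linarith) hθ
  rw [← div_eq_mul_inv, inv_eq_one_div, div_le_div_iff₀ (by positivity) (by positivity), mul_pow]
  have h5 : (0:ℝ) ≤ 5 ^ n * r ^ n := by positivity
  nlinarith [mul_le_mul_of_nonneg_right h h5]

theorem W_fin {n : ℕ} (ω : En n → ℝ) (h : LocallyIntegrable ω volume) (x : En n) (r : ℝ) :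
    ∫⁻ y in cube x r, ENNReal.ofReal (ω y) ≠ ∞ := by
  have := (h.integrableOn_isCompact (cube_compact x r)).lintegral_lt_top
  exact this.ne

theorem W_pos {n : ℕ} (ω : En n → ℝ) (h : LocallyIntegrable ω volume)
    (hpos : ∀ᵐ x ∂volume, 0 < ω x) (x : En n) (r : ℝ) (hr : 0 < r) :
    ∫⁻ y in cube x r, ENNReal.ofReal (ω y) ≠ 0 := by
  intro h0
  rw [lintegral_eq_zero_iff' h.aestronglyMeasurable.aemeasurable.ennreal_ofReal.restrict] at h0
  have h1 : ∀ᵐ y ∂(volume.restrict (cube x r)), False := by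
    filter_upwards [h0, ae_restrict_of_ae hpos] with y hy hy'
    simp only [Pi.zero_apply, ENNReal.ofReal_eq_zero] at hy
    linarith
  have h2 : volume (cube x r) = 0 := by
    simpa [ae_iff] using h1
  rw [cube_volume] at h2
  exact absurd h2 (pow_ne_zero _ (by simpa using hr))

theorem main_ineq (n : ℕ) (p θ : ℝ) (hp : 1 ≤ p) (hθ : 0 ≤ θ)
    (ω : En n → ℝ) (hω : ApTheta n p θ ω) (hpos : ∀ᵐ x ∂volume, 0 < ω x) :
    ∃ C > 0,
      (∀ (x : En n) (r : ℝ), 0 < r → ∀ f : En n → ℝ, Measurable f →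
        (ENNReal.ofReal ((1 + r) ^ θ) * volume (cube x r))⁻¹ *
            (∫⁻ y in cube x r, ENNReal.ofReal |f y|) ≤
          ENNReal.ofReal C *
            ((∫⁻ y in cube x (5 * r), ENNReal.ofReal (ω y))⁻¹ *
              ∫⁻ y in cube x r, ENNReal.ofReal (|f y| ^ p * ω y)) ^ (1 / p)) := by
  obtain ⟨hnn, hloc, C, hC, hA⟩ := hω
  refine ⟨5 ^ θ * 5 ^ n * C, by positivity, ?_⟩
  intro x r hr f hf
  have hA' := hA x (5 * r) (by linarith)
  have hD := D_le θ hθ x r hr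
  have hWf := W_fin ω hloc x (5 * r)
  have hW0 := W_pos ω hloc hpos x (5 * r) (by linarith)
  have hωm : AEMeasurable (fun y => ENNReal.ofReal (ω y)) volume :=
    hloc.aestronglyMeasurable.aemeasurable.ennreal_ofReal
  have hfm : Measurable (fun y => ENNReal.ofReal |f y|) := (by fun_prop)
  rw [ENNReal.ofReal_mul (by positivity)]
  generalize hDD : (ENNReal.ofReal ((1 + 5 * r) ^ θ) * volume (cube x (5 * r)))⁻¹ = D' at *
  generalize (ENNReal.ofReal ((1 + r) ^ θ) * volume (cube x r))⁻¹ = D at *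
  generalize hWW : ∫⁻ y in cube x (5 * r), ENNReal.ofReal (ω y) = W at *
  generalize ENNReal.ofReal (5 ^ θ * 5 ^ n) = K at *
  generalize ENNReal.ofReal C = C0 at *
  refine (mul_le_mul_left hD _).trans ?_
  rw [mul_assoc, mul_assoc]
  refine mul_le_mul_right ?_ _
  have hint : ∫⁻ y in cube x r, ENNReal.ofReal (|f y| ^ p * ω y) =
      ∫⁻ y in cube x r, ENNReal.ofReal |f y| ^ p * ENNReal.ofReal (ω y) := by
    refine lintegral_congr fun y => ?_
    rw [ENNReal.ofReal_mul (by positivity), ENNReal.ofReal_rpow_of_nonneg (abs_nonneg _) (by linarith)]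
  rw [hint]
  by_cases h1 : p = 1
  · subst h1
    simp only [if_true, ENNReal.rpow_one, div_one] at hA' ⊢
    set e := essInf (fun y => ENNReal.ofReal (ω y)) (volume.restrict (cube x (5 * r))) with he
    have hle : e * ∫⁻ y in cube x r, ENNReal.ofReal |f y| ≤
        ∫⁻ y in cube x r, ENNReal.ofReal |f y| * ENNReal.ofReal (ω y) := by
      rw [← lintegral_const_mul _ hfm]
      refine lintegral_mono_ae ?_
      have hh : ∀ᵐ y ∂(volume.restrict (cube x (5 * r))), e ≤ ENNReal.ofReal (ω y) :=
        ae_essInf_le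
      filter_upwards [ae_restrict_of_ae_restrict_of_subset (cube_mono x hr) hh] with y hy
      rw [mul_comm]
      exact mul_le_mul_right hy _
    calc D' * ∫⁻ y in cube x r, ENNReal.ofReal |f y|
        = W⁻¹ * (D' * W) * ∫⁻ y in cube x r, ENNReal.ofReal |f y| := by
          rw [mul_left_comm, ENNReal.inv_mul_cancel hW0 hWf, mul_one]
      _ ≤ W⁻¹ * (C0 * e) * ∫⁻ y in cube x r, ENNReal.ofReal |f y| := by gcongr
      _ = C0 * (W⁻¹ * (e * ∫⁻ y in cube x r, ENNReal.ofReal |f y|)) := by ring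
      _ ≤ _ := by gcongr
  · have hp1 : 1 < p := lt_of_le_of_ne hp (Ne.symm h1)
    have hp0 : 0 < p := by linarith
    rw [if_neg h1] at hA'
    have hq : p.HolderConjugate (p / (p - 1)) := Real.HolderConjugate.conjExponent hp1
    set S := ∫⁻ y in cube x (5 * r), ENNReal.ofReal (ω y) ^ (-1 / (p - 1)) with hS
    set F := ∫⁻ y in cube x r, ENNReal.ofReal |f y| ^ p * ENNReal.ofReal (ω y) with hF
    have hs : 1 / (p / (p - 1)) = 1 - 1 / p := by field_simp
    have hs0 : 0 ≤ 1 - 1 / p := by rw [← hs]; exact (one_div_pos.2 hq.symm.pos).le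
    have hH : ∫⁻ y in cube x r, ENNReal.ofReal |f y| ≤ F ^ (1 / p) * S ^ (1 - 1 / p) := by
      have h := ENNReal.lintegral_mul_le_Lp_mul_Lq (volume.restrict (cube x r)) hq
        (f := fun y => ENNReal.ofReal |f y| * ENNReal.ofReal (ω y) ^ (1 / p))
        (g := fun y => ENNReal.ofReal (ω y) ^ (-(1 / p)))
        (hfm.aemeasurable.mul (hωm.restrict.pow_const _)) (hωm.restrict.pow_const _)
      rw [hs] at h
      refine (le_trans (le_of_eq ?_) h).trans (mul_le_mul' (le_of_eq ?_) ?_)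
      · refine lintegral_congr_ae ?_
        filter_upwards [ae_restrict_of_ae hpos] with y hy
        have : ENNReal.ofReal (ω y) ≠ 0 := by simpa using hy
        simp only [Pi.mul_apply]
        rw [mul_assoc, ← ENNReal.rpow_add _ _ this ENNReal.ofReal_ne_top]
        simp
      · congr 1
        refine lintegral_congr fun y => ?_
        rw [ENNReal.mul_rpow_of_nonneg _ _ hp0.le, ← ENNReal.rpow_mul]
        congr 1
        rw [one_div_mul_cancel hp0.ne', ENNReal.rpow_one]
      · refine ENNReal.rpow_le_rpow ?_ hs0
        refine le_trans (le_of_eq ?_) (lintegral_mono_set (cube_mono x hr))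
        refine lintegral_congr fun y => ?_
        rw [← ENNReal.rpow_mul]
        congr 1
        have : p - 1 ≠ 0 := by linarith
        field_simp
    have hD' : D' = D' ^ (1 / p) * D' ^ (1 - 1 / p) := by
      rw [← ENNReal.rpow_add_of_nonneg _ _ (by positivity) hs0]
      simp
    have hWp0 : W ^ (1 / p) ≠ 0 := by
      simp [hW0, hWf, ENNReal.rpow_eq_zero_iff]
    have hWpf : W ^ (1 / p) ≠ ∞ := ENNReal.rpow_ne_top_of_nonneg (by positivity) hWf
    have hi : 0 ≤ 1 / p := by positivity
    rw [ENNReal.mul_rpow_of_nonneg _ _ hi, ENNReal.mul_rpow_of_nonneg _ _ hs0] at hA'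
    rw [ENNReal.mul_rpow_of_nonneg _ _ hi, ENNReal.inv_rpow]
    calc D' * ∫⁻ y in cube x r, ENNReal.ofReal |f y|
        ≤ D' * (F ^ (1 / p) * S ^ (1 - 1 / p)) := by gcongr
      _ = ((W ^ (1 / p))⁻¹ * W ^ (1 / p)) *
            (D' ^ (1 / p) * D' ^ (1 - 1 / p) * (F ^ (1 / p) * S ^ (1 - 1 / p))) := by
          rw [ENNReal.inv_mul_cancel hWp0 hWpf, one_mul, ← hD']
      _ = (D' ^ (1 / p) * W ^ (1 / p) * (D' ^ (1 - 1 / p) * S ^ (1 - 1 / p))) *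
            ((W ^ (1 / p))⁻¹ * F ^ (1 / p)) := by ring
      _ ≤ C0 * ((W ^ (1 / p))⁻¹ * F ^ (1 / p)) := by gcongr

/-- Lemma 2.2(iii): if `ω ∈ A_p^θ(φ)` then
`(φ(Q)^θ|Q|)⁻¹ ∫_Q |f| ≤ C (ω(5Q)⁻¹ ∫_Q |f|^p ω)^{1/p}`; in particular, for any
measurable `E ⊆ Q`, `|E|/(φ(Q)^θ|Q|) ≤ C (ω(E)/ω(5Q))^{1/p}`. -/
theorem stmt11 (n : ℕ) (hn : 0 < n) (p θ : ℝ) (hp : 1 ≤ p) (hθ : 0 ≤ θ)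
    (ω : En n → ℝ) (hω : ApTheta n p θ ω) (hpos : ∀ᵐ x ∂volume, 0 < ω x) :
    ∃ C > 0,
      (∀ (x : En n) (r : ℝ), 0 < r → ∀ f : En n → ℝ, Measurable f →
        (ENNReal.ofReal ((1 + r) ^ θ) * volume (cube x r))⁻¹ *
            (∫⁻ y in cube x r, ENNReal.ofReal |f y|) ≤
          ENNReal.ofReal C *
            ((∫⁻ y in cube x (5 * r), ENNReal.ofReal (ω y))⁻¹ *
              ∫⁻ y in cube x r, ENNReal.ofReal (|f y| ^ p * ω y)) ^ (1 / p)) ∧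
      (∀ (x : En n) (r : ℝ), 0 < r → ∀ E : Set (En n), MeasurableSet E →
        E ⊆ cube x r →
        volume E * (ENNReal.ofReal ((1 + r) ^ θ) * volume (cube x r))⁻¹ ≤
          ENNReal.ofReal C *
            ((∫⁻ y in E, ENNReal.ofReal (ω y)) /
              ∫⁻ y in cube x (5 * r), ENNReal.ofReal (ω y)) ^ (1 / p)) := by
  obtain ⟨C, hC, h⟩ := main_ineq n p θ hp hθ ω hω hpos
  refine ⟨C, hC, h, ?_⟩
  intro x r hr E hE hEs
  have h2 := h x r hr (E.indicator 1) (measurable_one.indicator hE)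
  have hp0 : p ≠ 0 := by linarith
  have e1 : ∫⁻ y in cube x r, ENNReal.ofReal |E.indicator (1 : En n → ℝ) y| = volume E := by
    have : (fun y => ENNReal.ofReal |E.indicator (1 : En n → ℝ) y|) = E.indicator 1 := by
      ext y
      by_cases hy : y ∈ E <;> simp [hy]
    rw [this, lintegral_indicator_one hE, Measure.restrict_apply hE, inter_eq_left.2 hEs]
  have e2 : ∫⁻ y in cube x r, ENNReal.ofReal (|E.indicator (1 : En n → ℝ) y| ^ p * ω y) =
      ∫⁻ y in E, ENNReal.ofReal (ω y) := by
    have : (fun y => ENNReal.ofReal (|E.indicator (1 : En n → ℝ) y| ^ p * ω y)) =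
        E.indicator (fun y => ENNReal.ofReal (ω y)) := by
      ext y
      by_cases hy : y ∈ E <;> simp [hy, Real.zero_rpow hp0]
    rw [this, lintegral_indicator hE, Measure.restrict_restrict hE, inter_eq_left.2 hEs]
  rw [e1, e2] at h2
  rw [mul_comm, ENNReal.div_eq_inv_mul]
  exact h2

end
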